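/- Let T : 𝒟 → Hol(𝔻) be a linear map (no continuity assumed) from the Dirichlet space into the space of holomorphic functions on 𝔻 such that T maps every nowhere-vanishing function in 𝒟 to a nowhere-vanishing holomorphic function. Then there exist holomorphic functions φ : 𝔻 → 𝔻 and ψ : 𝔻 → ℂ∖{0} such that (Tf)(z) = ψ(z)·f(φ(z)) for all f ∈ 𝒟 and all z ∈ 𝔻. -/

import Mathlib

open Complex MeasureTheory Metric Set

/-- Membership in the Dirichlet space `𝒟`: `f` is holomorphic on the open unit
disk and its Dirichlet integral `(1/π)∫_𝔻 |f′|² dA` is finite (equivalently,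
`|f′|²` is integrable on the disk). -/
def MemDirichlet (f : ℂ → ℂ) : Prop :=
  DifferentiableOn ℂ f (Metric.ball 0 1) ∧
    MeasureTheory.IntegrableOn (fun z => ‖deriv f z‖ ^ 2) (Metric.ball 0 1)

open scoped InnerProductSpace in
theorem exists_sub_of_selfPolar {H : Type*} [NormedAddCommGroup H] [InnerProductSpace ℝ H]
    [CompleteSpace H] (S : Set H) (hS : ∀ x ∈ S, ∀ y ∈ S, 0 ≤ ⟪x, y⟫_ℝ) (f : H) :
    ∃ p q : H, f = p - q ∧ (∀ x ∈ S, 0 ≤ ⟪x, p⟫_ℝ) ∧ (∀ x ∈ S, 0 ≤ ⟪x, q⟫_ℝ) ∧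
      ‖p‖ ≤ ‖f‖ ∧ ‖q‖ ≤ 2 * ‖f‖ := by
  set K : Set H := {a | ∀ x ∈ S, 0 ≤ ⟪x, a⟫_ℝ} with hK
  have h0 : (0 : H) ∈ K := by intro x _; simp
  have hadd : ∀ a ∈ K, ∀ b ∈ K, a + b ∈ K := by
    intro a ha b hb x hx
    rw [inner_add_right]
    exact add_nonneg (ha x hx) (hb x hx)
  have hsmul : ∀ a ∈ K, ∀ c : ℝ, 0 ≤ c → c • a ∈ K := by
    intro a ha c hc x hx
    rw [inner_smul_right]
    exact mul_nonneg hc (ha x hx)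
  have hconv : Convex ℝ K := by
    intro a ha b hb s t hs ht _
    exact hadd _ (hsmul a ha s hs) _ (hsmul b hb t ht)
  have hclosed : IsClosed K := by
    have : K = ⋂ x ∈ S, {a | 0 ≤ ⟪x, a⟫_ℝ} := by ext; simp [hK]
    rw [this]
    exact isClosed_biInter fun x _ => isClosed_le continuous_const (by fun_prop)
  obtain ⟨p, hp, hmin⟩ :=
    exists_norm_eq_iInf_of_complete_convex ⟨0, h0⟩ hclosed.isComplete hconv f
  have hpolar := (norm_eq_iInf_iff_real_inner_le_zero hconv hp).1 hmin
  have h1 : ∀ k ∈ K, ⟪f - p, k⟫_ℝ ≤ 0 := by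
    intro k hk
    simpa using hpolar (p + k) (hadd p hp k hk)
  have h2 : ⟪f - p, p⟫_ℝ = 0 := by
    have := hpolar 0 h0
    rw [zero_sub, inner_neg_right] at this
    exact le_antisymm (h1 p hp) (by linarith)
  have hnorm : ‖p‖ ≤ ‖f‖ := by
    have h3 : ⟪f, p⟫_ℝ = ‖p‖ * ‖p‖ := by
      rw [inner_sub_left, real_inner_self_eq_norm_mul_norm] at h2
      linarith
    have h4 := real_inner_le_norm f p
    rw [h3] at h4
    by_contra! hlt
    nlinarith [norm_nonneg f]
  refine ⟨p, p - f, by abel, hp, ?_, hnorm, ?_⟩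
  · intro x hx
    have := h1 x (fun y hy => hS y hy x hx)
    rw [← neg_sub, inner_neg_right, real_inner_comm]
    linarith
  · linarith [norm_sub_le p f]

open scoped InnerProductSpace in
theorem continuous_of_nonneg_on_dual {H : Type*} [NormedAddCommGroup H] [InnerProductSpace ℝ H]
    [CompleteSpace H] (S : Set H) (hS : ∀ x ∈ S, ∀ y ∈ S, 0 ≤ ⟪x, y⟫_ℝ) (l : H →ₗ[ℝ] ℝ)
    (hl : ∀ a, (∀ x ∈ S, 0 ≤ ⟪x, a⟫_ℝ) → 0 ≤ l a) : Continuous l := by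
  obtain ⟨C, hC⟩ : ∃ C : ℝ, ∀ a, (∀ x ∈ S, 0 ≤ ⟪x, a⟫_ℝ) → l a ≤ C * ‖a‖ := by
    by_contra! hcon
    have hex : ∀ n : ℕ, ∃ a, (∀ x ∈ S, 0 ≤ ⟪x, a⟫_ℝ) ∧ ‖a‖ ≤ (1 / 2 : ℝ) ^ n ∧ 1 ≤ l a := by
      intro n
      obtain ⟨a, ha, hlt⟩ := hcon (2 ^ n)
      have hpos : 0 < l a := lt_of_le_of_lt (by positivity) hlt
      refine ⟨(l a)⁻¹ • a, ?_, ?_, ?_⟩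
      · intro x hx
        rw [inner_smul_right]
        exact mul_nonneg (by positivity) (ha x hx)
      · rw [norm_smul, norm_inv, Real.norm_of_nonneg hpos.le, one_div, inv_pow,
          inv_mul_le_iff₀ hpos, ← div_eq_mul_inv, le_div_iff₀ (by positivity)]
        linarith
      · simp [hpos.ne']
    choose a ha hn h1 using hex
    have hsum : Summable a :=
      Summable.of_norm_bounded (summable_geometric_of_lt_one (by norm_num) (by norm_num)) hn
    have hbound : ∀ N : ℕ, (N : ℝ) ≤ l (∑' n, a n) := by
      intro N
      have hsplit := hsum.sum_add_tsum_nat_add N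
      have htail : 0 ≤ l (∑' n, a (n + N)) := by
        apply hl
        intro x hx
        have hs : Summable fun n => a (n + N) := (summable_nat_add_iff N).2 hsum
        have := hs.hasSum.mapL (innerSL ℝ x)
        exact this.nonneg fun n => by simpa using ha (n + N) x hx
      rw [← hsplit, map_add, map_sum]
      have : (N : ℝ) ≤ ∑ i ∈ Finset.range N, l (a i) := by
        calc (N : ℝ) = ∑ i ∈ Finset.range N, (1 : ℝ) := by simp
          _ ≤ _ := Finset.sum_le_sum fun i _ => h1 i
      linarith
    obtain ⟨N, hN⟩ := exists_nat_gt (l (∑' n, a n))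
    linarith [hbound N]
  refine AddMonoidHomClass.continuous_of_bound l (2 * |C|) fun f => ?_
  obtain ⟨p, q, rfl, hp, hq, hpn, hqn⟩ := exists_sub_of_selfPolar S hS f
  have hCp : l p ≤ |C| * ‖p‖ :=
    (hC p hp).trans (mul_le_mul_of_nonneg_right (le_abs_self C) (norm_nonneg _))
  have hCq : l q ≤ |C| * ‖q‖ :=
    (hC q hq).trans (mul_le_mul_of_nonneg_right (le_abs_self C) (norm_nonneg _))
  have := hl p hp
  have := hl q hq
  have e1 := mul_le_mul_of_nonneg_left hpn (abs_nonneg C)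
  have e2 := mul_le_mul_of_nonneg_left hqn (abs_nonneg C)
  have e3 : 0 ≤ |C| * ‖p - q‖ := by positivity
  rw [map_sub, Real.norm_eq_abs, abs_le]
  constructor <;> nlinarith

theorem Multiset.sum_sq_eq_sq_sum_sub_esymm {R : Type*} [CommRing R] (s : Multiset R) :
    (s.map (· ^ 2)).sum = s.sum ^ 2 - 2 * s.esymm 2 := by
  induction s using Multiset.induction with
  | empty => simp [Multiset.esymm, Multiset.powersetCard_zero_right 1]
  | cons a s ih =>
    have : (a ::ₘ s).esymm 2 = s.esymm 2 + a * s.sum := by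
      simpa [Multiset.esymm, Multiset.powersetCard_cons, Multiset.powersetCard_one,
        Multiset.map_map] using Multiset.sum_map_mul_left (s := s) (a := a) (f := id)
    rw [this, Multiset.map_cons, Multiset.sum_cons, Multiset.sum_cons, ih]
    ring

open Polynomial in
theorem Polynomial.map_sq_of_ne_zero_on_ball (L : ℂ[X] →ₗ[ℂ] ℂ) (h1 : L 1 = 1)
    (hL : ∀ p : ℂ[X], (∀ z ∈ ball (0 : ℂ) 1, p.eval z ≠ 0) → L p ≠ 0) (p : ℂ[X]) :
    L (p ^ 2) = L p ^ 2 := by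
  obtain ⟨M, hM⟩ : ∃ M : ℝ, ∀ z ∈ closedBall (0 : ℂ) 1, ‖p.eval z‖ ≤ M :=
    (isCompact_closedBall (0 : ℂ) 1).exists_bound_of_continuousOn p.continuous.continuousOn
  have key : ∀ n : ℕ, 2 ≤ n → ‖(n : ℂ) ^ 2 * L p ^ 2 - n * (n - 1) * L (p ^ 2)‖ ≤ n * M ^ 2 := by
    intro n hn
    set Q : ℂ[X] := ∑ k ∈ Finset.range (n + 1),
      Polynomial.C ((n.choose k : ℂ) * L ((-p) ^ (n - k))) * X ^ k
      with hQ
    have hcoeff : ∀ k ≤ n, Q.coeff k = (n.choose k : ℂ) * L ((-p) ^ (n - k)) := by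
      intro k hk
      simp only [hQ, finsetSum_coeff, coeff_C_mul, coeff_X_pow]
      rw [Finset.sum_eq_single k]
      · simp
      · intro j _ hj
        simp [hj.symm]
      · intro h
        exact absurd (Finset.mem_range.2 (by omega)) h
    have hdegle : Q.natDegree ≤ n := by
      refine natDegree_sum_le_of_forall_le _ _ fun k hk => ?_
      exact (natDegree_C_mul_X_pow_le _ _).trans (by have := Finset.mem_range.1 hk; omega)
    have hlead : Q.coeff n = 1 := by rw [hcoeff n le_rfl]; simp [h1]
    have hmonic : Q.Monic := monic_of_natDegree_le_of_coeff_eq_one n hdegle hlead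
    have hdeg : Q.natDegree = n :=
      le_antisymm hdegle (le_natDegree_of_ne_zero (by simp [hlead]))
    have heval : ∀ t : ℂ, Q.eval t = L ((Polynomial.C t - p) ^ n) := by
      intro t
      rw [sub_eq_add_neg, add_pow, map_sum, hQ, eval_finsetSum]
      refine Finset.sum_congr rfl fun k _ => ?_
      have : Polynomial.C t ^ k * (-p) ^ (n - k) * (n.choose k : ℂ[X])
          = (t ^ k * (n.choose k : ℂ)) • (-p) ^ (n - k) := by
        rw [smul_eq_C_mul, map_mul, map_pow, map_natCast]
        ring
      rw [this, map_smul]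
      simp
      ring
    have hroots : ∀ b ∈ Q.roots, ‖b‖ ≤ M := by
      intro b hb
      have hb0 : Q.eval b = 0 := (mem_roots'.1 hb).2
      rw [heval] at hb0
      by_contra! hlt
      refine hL _ (fun z hz => ?_) hb0
      rw [eval_pow, eval_sub, eval_C]
      refine pow_ne_zero _ (sub_ne_zero.2 fun h => ?_)
      have := hM z (ball_subset_closedBall hz)
      rw [← h] at this
      linarith
    have hsplits : Q.Splits := IsAlgClosed.splits Q
    have hcard : Multiset.card Q.roots = n := by
      rw [← hdeg]; exact hsplits.natDegree_eq_card_roots.symm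
    have hsum : Q.roots.sum = n * L p := by
      have := coeff_eq_esymm_roots_of_card (p := Q) (by rw [hcard, hdeg])
        (k := n - 1) (by omega)
      rw [hcoeff _ (by omega), hdeg, hmonic.leadingCoeff, show n - (n - 1) = 1 by omega,
        Nat.choose_symm (by omega : 1 ≤ n)] at this
      simp [Multiset.esymm, Multiset.powersetCard_one] at this
      rw [this]
    have hesymm : 2 * Q.roots.esymm 2 = n * (n - 1) * L (p ^ 2) := by
      have := coeff_eq_esymm_roots_of_card (p := Q) (by rw [hcard, hdeg])
        (k := n - 2) (by omega)
      rw [hcoeff _ (by omega), hdeg, hmonic.leadingCoeff, show n - (n - 2) = 2 by omega,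
        Nat.choose_symm (by omega : 2 ≤ n)] at this
      simp only [even_two, Even.neg_pow, one_pow, one_mul, mul_one] at this
      rw [← this, Nat.cast_choose_two]
      ring
    rw [← hesymm, ← mul_pow, ← hsum, ← Multiset.sum_sq_eq_sq_sum_sub_esymm]
    calc ‖(Q.roots.map (· ^ 2)).sum‖ ≤ ((Q.roots.map (· ^ 2)).map norm).sum :=
          norm_multiset_sum_le _
      _ ≤ Multiset.card ((Q.roots.map (· ^ 2)).map norm) • M ^ 2 := by
          refine Multiset.sum_le_card_nsmul _ _ fun x hx => ?_
          simp only [Multiset.map_map, Multiset.mem_map, Function.comp_apply, norm_pow] at hx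
          obtain ⟨b, hb, rfl⟩ := hx
          exact pow_le_pow_left₀ (norm_nonneg _) (hroots b hb) 2
      _ = n * M ^ 2 := by simp [hcard]
  have hbd : ∀ n : ℕ, 2 ≤ n → n * ‖L p ^ 2 - L (p ^ 2)‖ ≤ M ^ 2 + ‖L (p ^ 2)‖ := by
    intro n hn
    have hn0 : (0 : ℝ) < n := by positivity
    have e : (n : ℂ) * (n * (L p ^ 2 - L (p ^ 2)))
        = ((n : ℂ) ^ 2 * L p ^ 2 - n * (n - 1) * L (p ^ 2)) - n * L (p ^ 2) := by ring
    have := norm_sub_le ((n : ℂ) ^ 2 * L p ^ 2 - n * (n - 1) * L (p ^ 2)) (n * L (p ^ 2))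
    rw [← e, norm_mul, norm_mul, norm_mul, Complex.norm_natCast] at this
    have := key n hn
    refine le_of_mul_le_mul_left ?_ hn0
    linarith
  by_contra hne
  have hpos : 0 < ‖L p ^ 2 - L (p ^ 2)‖ := norm_pos_iff.2 (sub_ne_zero.2 (Ne.symm hne))
  obtain ⟨n, hn⟩ := exists_nat_gt ((M ^ 2 + ‖L (p ^ 2)‖) / ‖L p ^ 2 - L (p ^ 2)‖)
  rw [div_lt_iff₀ hpos] at hn
  have := hbd (n + 2) (by omega)
  push_cast at this
  nlinarith

open Polynomial in
theorem Polynomial.map_X_pow_of_ne_zero_on_ball (L : ℂ[X] →ₗ[ℂ] ℂ) (h1 : L 1 = 1)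
    (hL : ∀ p : ℂ[X], (∀ z ∈ ball (0 : ℂ) 1, p.eval z ≠ 0) → L p ≠ 0) (n : ℕ) :
    L (X ^ n) = L X ^ n := by
  induction n with
  | zero => simpa using h1
  | succ n ih =>
    have h := map_sq_of_ne_zero_on_ball L h1 hL (X ^ n + X)
    rw [show ((X : ℂ[X]) ^ n + X) ^ 2 = (X ^ n) ^ 2 + (2 : ℂ) • X ^ (n + 1) + X ^ 2 by
      rw [smul_eq_C_mul, map_ofNat]; ring, map_add, map_add, map_add, map_smul,
      map_sq_of_ne_zero_on_ball L h1 hL, map_sq_of_ne_zero_on_ball L h1 hL, ih, smul_eq_mul] at h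
    linear_combination h / 2

open scoped Real ComplexConjugate in
theorem hasSum_integral_norm_sq_of_summable {c : ℕ → ℂ} (hc : Summable fun n => ‖c n‖) :
    HasSum (fun n => 2 * π * ‖c n‖ ^ 2)
      (∫ t in Ioo (-π) π, ‖∑' n, c n * exp (n * t * I)‖ ^ 2) := by
  set e : ℕ → ℝ → ℂ := fun n t => c n * exp (n * t * I) with he
  have hecont : ∀ n, Continuous (e n) := fun n => by simp only [he]; fun_prop
  have henorm : ∀ n t, ‖e n t‖ = ‖c n‖ := by
    intro n t
    have : ((n : ℂ) * t * I) = ((n * t : ℝ) : ℂ) * I := by push_cast; ring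
    simp only [he]
    rw [norm_mul, this, norm_exp_ofReal_mul_I, mul_one]
  set F : ℕ × ℕ → ℝ → ℂ := fun p t => e p.1 t * conj (e p.2 t) with hF
  have hFcont : ∀ p, Continuous (F p) := fun p =>
    (hecont p.1).mul (continuous_conj.comp (hecont p.2))
  have hFnorm : ∀ p t, ‖F p t‖ = ‖c p.1‖ * ‖c p.2‖ := by
    intro p t
    simp only [hF]
    rw [norm_mul, RCLike.norm_conj, henorm, henorm]
  have hFint : ∀ p, Integrable (F p) (volume.restrict (Ioo (-π) π)) := fun p =>
    ((hFcont p).integrableOn_Icc (a := -π) (b := π)).mono_set Ioo_subset_Icc_self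
  have hsumF : ∀ t, ∑' p, F p t = ((‖∑' n, e n t‖ ^ 2 : ℝ) : ℂ) := by
    intro t
    have hs : Summable fun n => ‖e n t‖ := by simpa only [henorm] using hc
    have hs' : Summable fun n => ‖conj (e n t)‖ := by simpa only [RCLike.norm_conj] using hs
    rw [← tsum_mul_tsum_of_summable_norm hs hs', ← Complex.conj_tsum, mul_conj, normSq_eq_norm_sq]
  have hInt : ∀ p, ∫ t in Ioo (-π) π, F p t
      = if p.1 = p.2 then ((2 * π * ‖c p.1‖ ^ 2 : ℝ) : ℂ) else 0 := by
    rintro ⟨m, k⟩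
    have hpi : (-π) ≤ π := by linarith [Real.pi_pos]
    rw [← integral_Ioc_eq_integral_Ioo, ← intervalIntegral.integral_of_le hpi]
    have hFe : ∀ t : ℝ, F (m, k) t = c m * conj (c k) * exp (((m : ℂ) - k) * I * t) := by
      intro t
      simp only [hF, he, map_mul, ← exp_conj, conj_I, conj_ofReal, map_natCast]
      rw [show ((m : ℂ) - k) * I * t = m * t * I + k * t * -I by ring, Complex.exp_add]
      ring
    simp only [hFe, intervalIntegral.integral_const_mul]
    split_ifs with h
    · subst h
      simp [mul_conj, normSq_eq_norm_sq]
      ring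
    · have hne : ((m : ℂ) - k) * I ≠ 0 := by
        refine mul_ne_zero (sub_ne_zero.2 ?_) I_ne_zero
        exact_mod_cast h
      rw [integral_exp_mul_complex hne]
      have : exp (((m : ℂ) - k) * I * (π : ℝ)) = exp (((m : ℂ) - k) * I * ((-π : ℝ) : ℂ)) := by
        rw [Complex.exp_eq_exp_iff_exists_int]
        exact ⟨(m : ℤ) - k, by push_cast; ring⟩
      rw [this]
      simp
  have hmain := hasSum_integral_of_summable_integral_norm hFint (by
    simp only [hFnorm]
    simp only [integral_const]
    exact (hc.mul_of_nonneg hc (fun _ => norm_nonneg _) fun _ => norm_nonneg _).const_smul _)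
  simp only [hInt, hsumF] at hmain
  rw [integral_complex_ofReal] at hmain
  have hinj : Function.Injective fun n : ℕ => (n, n) := fun a b h => (Prod.mk.inj h).1
  rw [← hinj.hasSum_iff] at hmain
  · simp only [Function.comp_def, if_true] at hmain
    exact Complex.hasSum_ofReal.1 hmain
  · rintro ⟨m, k⟩ hx
    exact if_neg fun h => hx ⟨m, Prod.ext rfl h⟩

open scoped Real ENNReal in
theorem lintegral_ball_norm_sq_eq_tsum {b : ℕ → ℂ} {g : ℂ → ℂ} (hg : ContinuousOn g (ball 0 1))
    (hb : ∀ z ∈ ball (0 : ℂ) 1, HasSum (fun n => b n * z ^ n) (g z)) :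
    ∫⁻ z in ball (0 : ℂ) 1, ENNReal.ofReal (‖g z‖ ^ 2)
      = ∑' n, ENNReal.ofReal (π * (‖b n‖ ^ 2 / (n + 1))) := by
  set G : ℂ → ℝ≥0∞ := (ball (0 : ℂ) 1).indicator fun z => ENNReal.ofReal (‖g z‖ ^ 2) with hG
  have hGmeas : Measurable G := by
    classical
    rw [hG, ← piecewise_eq_indicator]
    exact ContinuousOn.measurable_piecewise
      (ENNReal.continuous_ofReal.comp_continuousOn (hg.norm.pow 2)) continuousOn_const
      measurableSet_ball
  have hpolar : ∀ p : ℝ × ℝ, Complex.polarCoord.symm p = p.1 * exp (p.2 * I) := by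
    intro p
    rw [Complex.polarCoord_symm_apply, exp_mul_I, ofReal_cos, ofReal_sin]
  rw [← lintegral_indicator measurableSet_ball, ← hG, ← Complex.lintegral_comp_polarCoord_symm,
    polarCoord_target, Measure.volume_eq_prod, ← Measure.prod_restrict, lintegral_prod]
  rotate_left
  · simp only [hpolar, smul_eq_mul]
    fun_prop
  have hinner : ∀ r ∈ Ioi (0 : ℝ), ∫⁻ t in Ioo (-π) π,
      ENNReal.ofReal r • G (Complex.polarCoord.symm (r, t))
      = (Ioo (0 : ℝ) 1).indicator
        (fun r => ∑' n, ENNReal.ofReal (2 * π * ‖b n‖ ^ 2 * r ^ (2 * n + 1))) r := by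
    intro r hr
    have hr0 : 0 < r := hr
    have hnorm : ∀ t : ℝ, ‖(r : ℂ) * exp (t * I)‖ = r := by
      intro t
      rw [norm_mul, norm_exp_ofReal_mul_I, mul_one, norm_real, Real.norm_of_nonneg hr0.le]
    simp only [hpolar, smul_eq_mul]
    by_cases hr1 : r < 1
    · have hmem : ∀ t : ℝ, (r : ℂ) * exp (t * I) ∈ ball (0 : ℂ) 1 := by
        intro t
        rwa [mem_ball_zero_iff, hnorm]
      have hcs : Summable fun n => ‖b n * (r : ℂ) ^ n‖ := by
        have h := (hb (r : ℂ) (by simpa using hmem 0)).summable.norm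
        exact h
      rw [indicator_of_mem (show r ∈ Ioo (0 : ℝ) 1 from ⟨hr0, hr1⟩)]
      have hg' : ∀ t : ℝ, g (r * exp (t * I)) = ∑' n, b n * (r : ℂ) ^ n * exp (n * t * I) := by
        intro t
        rw [← (hb _ (hmem t)).tsum_eq]
        refine tsum_congr fun n => ?_
        rw [mul_pow, ← Complex.exp_nat_mul, mul_assoc, mul_assoc]
      have hcont : Continuous fun t : ℝ => ‖g (r * exp (t * I))‖ ^ 2 := by
        have : Continuous fun t : ℝ => g (r * exp (t * I)) :=
          hg.comp_continuous (by fun_prop) hmem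
        exact this.norm.pow 2
      have hpar := hasSum_integral_norm_sq_of_summable hcs
      simp only [← hg'] at hpar
      have hpar' := hpar.mul_left r
      simp only [hG, indicator_of_mem (hmem _)]
      rw [lintegral_const_mul' _ _ ENNReal.ofReal_ne_top,
        ← ofReal_integral_eq_lintegral_ofReal
          (hcont.integrableOn_Icc.mono_set Ioo_subset_Icc_self)
          (Filter.Eventually.of_forall fun _ => by positivity),
        ← ENNReal.ofReal_mul hr0.le, ← hpar'.tsum_eq,
        ENNReal.ofReal_tsum_of_nonneg (fun n => by positivity) hpar'.summable]
      refine tsum_congr fun n => ?_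
      congr 1
      rw [norm_mul, norm_pow, norm_real, Real.norm_of_nonneg hr0.le]
      ring
    · rw [indicator_of_notMem (fun h => hr1 h.2)]
      have : ∀ t : ℝ, G (r * exp (t * I)) = 0 := by
        intro t
        refine indicator_of_notMem ?_ _
        rwa [mem_ball_zero_iff, hnorm]
      simp [this]
  rw [setLIntegral_congr_fun measurableSet_Ioi hinner, lintegral_indicator measurableSet_Ioo,
    Measure.restrict_restrict measurableSet_Ioo, inter_eq_left.2 Ioo_subset_Ioi_self,
    lintegral_tsum (fun n => by fun_prop)]
  refine tsum_congr fun n => ?_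
  rw [← ofReal_integral_eq_lintegral_ofReal]
  · congr 1
    rw [← integral_Ioc_eq_integral_Ioo, ← intervalIntegral.integral_of_le zero_le_one,
      intervalIntegral.integral_const_mul, integral_pow]
    push_cast
    field_simp
    simp
    ring
  · refine (Continuous.integrableOn_Icc ?_).mono_set Ioo_subset_Icc_self
    fun_prop
  · refine (ae_restrict_iff' measurableSet_Ioo).2 (Filter.Eventually.of_forall fun r hr => ?_)
    have := hr.1.le
    positivity

theorem integrableOn_ball_norm_sq_iff_summable {b : ℕ → ℂ} {g : ℂ → ℂ}
    (hg : ContinuousOn g (ball 0 1))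
    (hb : ∀ z ∈ ball (0 : ℂ) 1, HasSum (fun n => b n * z ^ n) (g z)) :
    IntegrableOn (fun z => ‖g z‖ ^ 2) (ball 0 1) ↔ Summable fun n => ‖b n‖ ^ 2 / (n + 1) := by
  have hmeas : AEStronglyMeasurable (fun z => ‖g z‖ ^ 2) (volume.restrict (ball (0 : ℂ) 1)) :=
    (hg.norm.pow 2).aestronglyMeasurable measurableSet_ball
  rw [IntegrableOn, Integrable, and_iff_right hmeas,
    hasFiniteIntegral_iff_ofReal (Filter.Eventually.of_forall fun _ => by positivity),
    lintegral_ball_norm_sq_eq_tsum hg hb]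
  have hs : (Summable fun n : ℕ => Real.pi * (‖b n‖ ^ 2 / (n + 1))) ↔
      Summable fun n : ℕ => ‖b n‖ ^ 2 / (n + 1) := summable_mul_left_iff Real.pi_ne_zero
  rw [← hs]
  constructor
  · intro h
    have := ENNReal.summable_toReal h.ne
    refine this.congr fun n => ?_
    rw [ENNReal.toReal_ofReal (by positivity)]
  · exact fun h => h.tsum_ofReal_lt_top

theorem differentiableOn_and_hasSum_deriv_of_hasSum {c : ℕ → ℂ} {f : ℂ → ℂ}
    (hf : ∀ z ∈ ball (0 : ℂ) 1, HasSum (fun n => c n * z ^ n) (f z)) :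
    DifferentiableOn ℂ f (ball 0 1) ∧ ∀ z ∈ ball (0 : ℂ) 1,
      HasSum (fun n : ℕ => (n + 1) * c (n + 1) * z ^ n) (deriv f z) := by
  have key : ∀ z ∈ ball (0 : ℂ) 1, DifferentiableAt ℂ f z ∧
      HasSum (fun n : ℕ => (n + 1) * c (n + 1) * z ^ n) (deriv f z) := by
    intro z hz
    rw [mem_ball_zero_iff] at hz
    obtain ⟨r, hzr, hr1⟩ := exists_between hz
    have hr0 : 0 ≤ r := (norm_nonneg z).trans hzr.le
    have hrn : ‖(r : ℂ)‖ = r := by rw [norm_real, Real.norm_of_nonneg hr0]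
    have hu : Summable fun n => ‖c n * (r : ℂ) ^ n‖ :=
      (hf r (by rwa [mem_ball_zero_iff, hrn])).summable.norm
    have hle : ∀ (n : ℕ) (w : ℂ), w ∈ ball (0 : ℂ) r → ‖c n * w ^ n‖ ≤ ‖c n * (r : ℂ) ^ n‖ := by
      intro n w hw
      rw [norm_mul, norm_mul, norm_pow, norm_pow, hrn]
      rw [mem_ball_zero_iff] at hw
      gcongr
    have hd : ∀ n : ℕ, DifferentiableOn ℂ (fun w : ℂ => c n * w ^ n) (ball 0 r) :=
      fun n => by fun_prop
    have hzmem : z ∈ ball (0 : ℂ) r := by rwa [mem_ball_zero_iff]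
    have heq : f =ᶠ[nhds z] fun w => ∑' n, c n * w ^ n := by
      filter_upwards [isOpen_ball.mem_nhds hzmem] with w hw
      exact (hf w (ball_subset_ball hr1.le hw)).tsum_eq.symm
    refine ⟨?_, ?_⟩
    · exact (((differentiableOn_tsum_of_summable_norm hu hd isOpen_ball hle).differentiableAt
        (isOpen_ball.mem_nhds hzmem)).congr_of_eventuallyEq heq)
    · have h := hasSum_deriv_of_summable_norm hu hd isOpen_ball hle hzmem
      rw [← heq.deriv_eq, ← hasSum_nat_add_iff' 1] at h
      simp only [Finset.range_one, Finset.sum_singleton, pow_zero, mul_one, deriv_const,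
        sub_zero] at h
      refine h.congr_fun fun n => ?_
      rw [deriv_const_mul _ (by fun_prop), deriv_pow_field]
      push_cast
      ring
  exact ⟨fun z hz => (key z hz).1.differentiableWithinAt, fun z hz => (key z hz).2⟩

theorem continuousOn_deriv_ball {f : ℂ → ℂ}
    (hf : DifferentiableOn ℂ f (ball 0 1)) : ContinuousOn (deriv f) (ball 0 1) :=
  (hf.deriv isOpen_ball).continuousOn

theorem memDirichlet_of_hasSum {c : ℕ → ℂ} {f : ℂ → ℂ}
    (hf : ∀ z ∈ ball (0 : ℂ) 1, HasSum (fun n => c n * z ^ n) (f z))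
    (hc : Summable fun n : ℕ => (n + 1) * ‖c n‖ ^ 2) : MemDirichlet f := by
  obtain ⟨hd, hs⟩ := differentiableOn_and_hasSum_deriv_of_hasSum hf
  refine ⟨hd, (integrableOn_ball_norm_sq_iff_summable (continuousOn_deriv_ball hd) hs).2 ?_⟩
  refine ((summable_nat_add_iff 1).2 hc).of_nonneg_of_le (fun n => by positivity) fun n => ?_
  rw [norm_mul, div_le_iff₀ (by positivity)]
  have : ‖(n : ℂ) + 1‖ = n + 1 := by exact_mod_cast Complex.norm_natCast (n + 1)
  rw [this]
  push_cast
  have : 0 ≤ ‖c (n + 1)‖ ^ 2 * (n + 1) := by positivity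
  nlinarith

theorem MemDirichlet.exists_hasSum {f : ℂ → ℂ} (hf : MemDirichlet f) :
    ∃ c : ℕ → ℂ, (∀ z ∈ ball (0 : ℂ) 1, HasSum (fun n => c n * z ^ n) (f z)) ∧
      Summable fun n : ℕ => (n + 1) * ‖c n‖ ^ 2 := by
  obtain ⟨hd, hi⟩ := hf
  have hsum : ∀ z ∈ ball (0 : ℂ) 1,
      HasSum (fun n => ((n.factorial : ℂ)⁻¹ * iteratedDeriv n f 0) * z ^ n) (f z) := by
    intro z hz
    have := hasSum_taylorSeries_on_ball hd hz
    simp only [sub_zero, smul_eq_mul] at this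
    refine this.congr_fun fun n => ?_
    ring
  refine ⟨_, hsum, ?_⟩
  obtain ⟨-, hs⟩ := differentiableOn_and_hasSum_deriv_of_hasSum hsum
  have h := (integrableOn_ball_norm_sq_iff_summable (continuousOn_deriv_ball hd) hs).1 hi
  rw [← summable_nat_add_iff 1]
  refine (h.mul_left 2).of_nonneg_of_le (fun n => by positivity) fun n => ?_
  rw [norm_mul ((n : ℂ) + 1), ← mul_div_assoc, le_div_iff₀ (by positivity)]
  have : ‖(n : ℂ) + 1‖ = n + 1 := by exact_mod_cast Complex.norm_natCast (n + 1)
  rw [this]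
  push_cast
  set C := ‖((n + 1).factorial : ℂ)⁻¹ * iteratedDeriv (n + 1) f 0‖ with hC
  have h1 : 0 ≤ C ^ 2 * (n + 1) * n := by positivity
  nlinarith

theorem MemDirichlet.add {f g : ℂ → ℂ} (hf : MemDirichlet f) (hg : MemDirichlet g) :
    MemDirichlet (f + g) := by
  obtain ⟨c, hc, hc'⟩ := hf.exists_hasSum
  obtain ⟨d, hd, hd'⟩ := hg.exists_hasSum
  refine memDirichlet_of_hasSum (c := c + d) (fun z hz => ?_) ?_
  · simpa [add_mul] using (hc z hz).add (hd z hz)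
  · refine ((hc'.add hd').mul_left 2).of_nonneg_of_le (fun n => by positivity) fun n => ?_
    have h1 : ‖(c + d) n‖ ^ 2 ≤ 2 * (‖c n‖ ^ 2 + ‖d n‖ ^ 2) := by
      have := norm_add_le (c n) (d n)
      have h0 := norm_nonneg (c n + d n)
      rw [Pi.add_apply]
      nlinarith [sq_nonneg (‖c n‖ - ‖d n‖)]
    have h2 : (0 : ℝ) ≤ n + 1 := by positivity
    nlinarith [mul_le_mul_of_nonneg_left h1 h2]

theorem MemDirichlet.smul {f : ℂ → ℂ} (a : ℂ) (hf : MemDirichlet f) : MemDirichlet (a • f) := by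
  obtain ⟨c, hc, hc'⟩ := hf.exists_hasSum
  refine memDirichlet_of_hasSum (c := a • c) (fun z hz => ?_) ?_
  · simpa [mul_assoc] using (hc z hz).mul_left a
  · refine (hc'.mul_left (‖a‖ ^ 2)).congr fun n => ?_
    rw [Pi.smul_apply, norm_smul]
    ring

theorem memDirichlet_polynomial (p : Polynomial ℂ) : MemDirichlet fun z => p.eval z := by
  refine memDirichlet_of_hasSum (c := p.coeff) (fun z _ => ?_) ?_
  · rw [Polynomial.eval_eq_sum_range]
    refine hasSum_sum_of_ne_finset_zero fun n hn => ?_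
    rw [Polynomial.coeff_eq_zero_of_natDegree_lt (by simpa using hn), zero_mul]
  · refine summable_of_ne_finset_zero (s := Finset.range (p.natDegree + 1)) fun n hn => ?_
    rw [Polynomial.coeff_eq_zero_of_natDegree_lt (by simpa using hn)]
    simp

/-- The Dirichlet space as a complex vector space of functions. -/
def dirichletSubmodule : Submodule ℂ (ℂ → ℂ) where
  carrier := {f | MemDirichlet f}
  add_mem' := MemDirichlet.add
  zero_mem' := by simpa [Pi.zero_def] using memDirichlet_polynomial 0
  smul_mem' a _ hf := MemDirichlet.smul a hf

theorem re_nonneg_of_hasSum_pow_div {x s : ℂ} (hx : ‖x‖ < 1)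
    (hs : HasSum (fun n : ℕ => x ^ n / (n + 1)) s) : 0 ≤ s.re := by
  rcases eq_or_ne x 0 with rfl | hx0
  · have h1 : HasSum (fun n : ℕ => (0 : ℂ) ^ n / (n + 1)) 1 := by
      convert hasSum_single (f := fun n : ℕ => (0 : ℂ) ^ n / (n + 1)) 0 _ using 1
      · simp
      · intro n hn
        simp [hn]
    rw [hs.unique h1]
    simp
  have hlog : -log (1 - x) = x * s := by
    have h := hasSum_taylorSeries_neg_log hx
    rw [← hasSum_nat_add_iff' 1] at h
    simp only [Finset.range_one, Finset.sum_singleton, pow_zero, Nat.cast_zero, div_zero,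
      sub_zero] at h
    refine h.unique ?_
    refine (hs.mul_left x).congr_fun fun n => ?_
    push_cast
    rw [pow_succ]
    ring
  have hre : ∀ t ∈ Icc (0 : ℝ) 1, 0 < (1 - t * x).re := by
    intro t ht
    have h1 : (t * x).re ≤ ‖(t : ℂ) * x‖ := re_le_norm _
    rw [norm_mul, norm_real, Real.norm_of_nonneg ht.1] at h1
    have h2 : t * ‖x‖ ≤ 1 * ‖x‖ := mul_le_mul_of_nonneg_right ht.2 (norm_nonneg _)
    rw [sub_re, one_re]
    linarith
  have hderiv : ∀ t ∈ Icc (0 : ℝ) 1,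
      HasDerivAt (fun t : ℝ => (-log (1 - t * x) / x).re) ((1 - t * x)⁻¹).re t := by
    intro t ht
    have h1 : HasDerivAt (fun t : ℂ => -log (1 - t * x) / x) ((1 - t * x)⁻¹) (t : ℂ) := by
      have h2 : HasDerivAt (fun t : ℂ => 1 - t * x) (-x) (t : ℂ) := by
        simpa using ((hasDerivAt_id (t : ℂ)).mul_const x).const_sub 1
      have h3 := ((h2.clog (Or.inl (hre t ht))).neg).div_const x
      refine h3.congr_deriv ?_
      field_simp
    exact h1.real_of_complex
  have hmono : MonotoneOn (fun t : ℝ => (-log (1 - t * x) / x).re) (Icc 0 1) := by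
    refine monotoneOn_of_deriv_nonneg (convex_Icc 0 1)
      (fun t ht => (hderiv t ht).continuousAt.continuousWithinAt)
      (fun t ht => (hderiv t (interior_subset ht)).differentiableAt.differentiableWithinAt)
      fun t ht => ?_
    rw [(hderiv t (interior_subset ht)).deriv, inv_re]
    exact div_nonneg (hre t (interior_subset ht)).le (normSq_nonneg _)
  have h := hmono (left_mem_Icc.2 zero_le_one) (right_mem_Icc.2 zero_le_one) zero_le_one
  have e : -log (1 - x) / x = s := by rw [hlog]; field_simp
  simpa [e] using h

open scoped lp in
theorem real_inner_eq_re_inner_lp (x y : ℓ²(ℕ, ℂ)) : inner ℝ x y = (inner ℂ x y : ℂ).re := by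
  refine (lp.hasSum_inner (𝕜 := ℝ) x y).unique ?_
  exact Complex.hasSum_re (lp.hasSum_inner (𝕜 := ℂ) x y)

open scoped ComplexConjugate in
theorem memℓp_dirichletKernel {z : ℂ} (hz : ‖z‖ < 1) :
    Memℓp (fun n : ℕ => conj z ^ n / (√(n + 1 : ℝ) : ℂ)) 2 := by
  refine memℓp_gen ?_
  have hz2 : ‖z‖ ^ 2 < 1 := pow_lt_one₀ (norm_nonneg _) hz two_ne_zero
  refine (summable_geometric_of_lt_one (by positivity) hz2).of_nonneg_of_le
    (fun n => by positivity) fun n => ?_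
  rw [ENNReal.toReal_ofNat, Real.rpow_two, norm_div, norm_pow, RCLike.norm_conj, norm_real,
    Real.norm_of_nonneg (Real.sqrt_nonneg _), div_pow, Real.sq_sqrt (by positivity), ← pow_mul,
    mul_comm n 2, pow_mul]
  exact div_le_self (by positivity) (by linarith [(Nat.cast_nonneg n : (0 : ℝ) ≤ n)])

open scoped Classical ComplexConjugate lp in
/-- The reproducing kernel of the Dirichlet space at `z`, for the norm `∑ (n + 1) |cₙ|²`, in the
coordinates `√(n + 1) cₙ`. -/
noncomputable def dirichletKernel (z : ℂ) : ℓ²(ℕ, ℂ) :=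
  if hz : ‖z‖ < 1 then ⟨_, memℓp_dirichletKernel hz⟩ else 0

open scoped ComplexConjugate in
theorem dirichletKernel_apply {z : ℂ} (hz : ‖z‖ < 1) (n : ℕ) :
    dirichletKernel z n = conj z ^ n / (√(n + 1 : ℝ) : ℂ) := by
  rw [dirichletKernel, dif_pos hz]

open scoped lp in
theorem hasSum_inner_dirichletKernel {z : ℂ} (hz : ‖z‖ < 1) (a : ℓ²(ℕ, ℂ)) :
    HasSum (fun n => a n / (√(n + 1 : ℝ) : ℂ) * z ^ n) (inner ℂ (dirichletKernel z) a) := by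
  refine (lp.hasSum_inner (𝕜 := ℂ) (dirichletKernel z) a).congr_fun fun n => ?_
  rw [dirichletKernel_apply hz, RCLike.inner_apply]
  simp only [map_div₀, map_pow, conj_conj, conj_ofReal]
  ring

theorem re_inner_dirichletKernel_nonneg (z w : ℂ) :
    0 ≤ (inner ℂ (dirichletKernel z) (dirichletKernel w) : ℂ).re := by
  by_cases hz : ‖z‖ < 1
  swap
  · simp [dirichletKernel, hz]
  by_cases hw : ‖w‖ < 1
  swap
  · simp [dirichletKernel, hw]
  refine re_nonneg_of_hasSum_pow_div (x := z * starRingEnd ℂ w) ?_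
    ((hasSum_inner_dirichletKernel hz (dirichletKernel w)).congr_fun fun n => ?_)
  · rw [norm_mul, RCLike.norm_conj]
    exact mul_lt_one_of_nonneg_of_lt_one_left (norm_nonneg _) hz hw.le
  · rw [dirichletKernel_apply hw, div_div, ← ofReal_mul, Real.mul_self_sqrt (by positivity),
      mul_pow]
    push_cast
    ring

open scoped lp in
theorem memDirichlet_inner_dirichletKernel (a : ℓ²(ℕ, ℂ)) :
    MemDirichlet fun z => inner ℂ (dirichletKernel z) a := by
  refine memDirichlet_of_hasSum
    (fun z hz => hasSum_inner_dirichletKernel (mem_ball_zero_iff.1 hz) a) ?_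
  have h := (lp.memℓp a).summable (by norm_num)
  refine h.congr fun n => ?_
  rw [ENNReal.toReal_ofNat, Real.rpow_two, norm_div, norm_real,
    Real.norm_of_nonneg (Real.sqrt_nonneg _), div_pow, Real.sq_sqrt (by positivity)]
  field_simp

open scoped lp in
theorem MemDirichlet.exists_eqOn_inner {f : ℂ → ℂ} (hf : MemDirichlet f) :
    ∃ a : ℓ²(ℕ, ℂ), EqOn (fun z => inner ℂ (dirichletKernel z) a) f (ball 0 1) := by
  obtain ⟨c, hc, hc'⟩ := hf.exists_hasSum
  have hne : ∀ n : ℕ, ((√(n + 1 : ℝ) : ℝ) : ℂ) ≠ 0 := fun n => by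
    rw [ofReal_ne_zero]; positivity
  have hmem : Memℓp (fun n : ℕ => c n * (√(n + 1 : ℝ) : ℂ)) 2 := by
    refine memℓp_gen (hc'.congr fun n => ?_)
    rw [ENNReal.toReal_ofNat, Real.rpow_two, norm_mul, norm_real,
      Real.norm_of_nonneg (Real.sqrt_nonneg _), mul_pow, Real.sq_sqrt (by positivity), mul_comm]
  refine ⟨⟨_, hmem⟩, fun z hz => ?_⟩
  refine (hasSum_inner_dirichletKernel (mem_ball_zero_iff.1 hz) _).unique
    ((hc z hz).congr_fun fun n => ?_)
  change c n * (√(n + 1 : ℝ) : ℂ) / (√(n + 1 : ℝ) : ℂ) * z ^ n = _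
  rw [mul_div_cancel_right₀ _ (hne n)]

open scoped lp in
/-- The holomorphic function with given coordinates, as a linear map onto the Dirichlet space. -/
noncomputable def dirichletSynthesis : ℓ²(ℕ, ℂ) →ₗ[ℂ] dirichletSubmodule where
  toFun a := ⟨fun z => inner ℂ (dirichletKernel z) a, memDirichlet_inner_dirichletKernel a⟩
  map_add' a b := by
    ext z
    exact inner_add_right _ _ _
  map_smul' c a := by
    ext z
    exact inner_smul_right _ _ _

/-- Polynomials as elements of the Dirichlet space. -/
noncomputable def polynomialToDirichlet : Polynomial ℂ →ₗ[ℂ] dirichletSubmodule where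
  toFun p := ⟨fun z => p.eval z, memDirichlet_polynomial p⟩
  map_add' p q := by
    ext z
    exact Polynomial.eval_add
  map_smul' c p := by
    ext z
    exact Polynomial.eval_smul (s := c) (p := p) (x := z)

open scoped lp in
/-- A linear functional on the Dirichlet space which does not vanish on nowhere-vanishing functions
and is normalised to take the value `1` at the constant `1` is a point evaluation. -/
theorem exists_eq_eval_of_ne_zero (L : dirichletSubmodule →ₗ[ℂ] ℂ)
    (hcongr : ∀ f g : dirichletSubmodule, EqOn f.1 g.1 (ball 0 1) → L f = L g)
    (h1 : L (polynomialToDirichlet 1) = 1)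
    (hL : ∀ f : dirichletSubmodule, (∀ z ∈ ball (0 : ℂ) 1, f.1 z ≠ 0) → L f ≠ 0) :
    L (polynomialToDirichlet Polynomial.X) ∈ ball (0 : ℂ) 1 ∧
      ∀ f : dirichletSubmodule, L f = f.1 (L (polynomialToDirichlet Polynomial.X)) := by
  have hmem : ∀ f : dirichletSubmodule, ∃ z ∈ ball (0 : ℂ) 1, f.1 z = L f := by
    intro f
    by_contra! hcon
    refine hL (f - L f • polynomialToDirichlet 1) (fun z hz => ?_) ?_
    · change f.1 z - L f * (1 : Polynomial ℂ).eval z ≠ 0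
      rw [Polynomial.eval_one, mul_one]
      exact sub_ne_zero.2 (hcon z hz)
    · rw [map_sub, map_smul, h1, smul_eq_mul, mul_one, sub_self]
  set w : ℂ := L (polynomialToDirichlet Polynomial.X) with hw
  have hwmem : w ∈ ball (0 : ℂ) 1 := by
    obtain ⟨z, hz, hzw⟩ := hmem (polynomialToDirichlet Polynomial.X)
    change (Polynomial.X : Polynomial ℂ).eval z = w at hzw
    rw [Polynomial.eval_X] at hzw
    rwa [← hzw]
  refine ⟨hwmem, ?_⟩
  have hpow : ∀ n, L (polynomialToDirichlet (Polynomial.X ^ n)) = w ^ n :=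
    Polynomial.map_X_pow_of_ne_zero_on_ball (L ∘ₗ polynomialToDirichlet) h1 fun p hp => hL _ hp
  set N : ℓ²(ℕ, ℂ) →ₗ[ℂ] ℂ := L ∘ₗ dirichletSynthesis with hN
  set d : ℓ²(ℕ, ℂ) →ₗ[ℂ] ℂ := N - (innerSL ℂ (dirichletKernel w)).toLinearMap with hd
  have hNcont : Continuous (reLm ∘ₗ N.restrictScalars ℝ) := by
    refine continuous_of_nonneg_on_dual (range dirichletKernel) ?_ _ ?_
    · rintro _ ⟨z, rfl⟩ _ ⟨z', rfl⟩
      rw [real_inner_eq_re_inner_lp]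
      exact re_inner_dirichletKernel_nonneg z z'
    · intro a ha
      obtain ⟨z, -, hz⟩ := hmem (dirichletSynthesis a)
      have := ha _ ⟨z, rfl⟩
      rw [real_inner_eq_re_inner_lp] at this
      change 0 ≤ (L (dirichletSynthesis a)).re
      rw [← hz]
      exact this
  have hdcont : Continuous fun a => (d a).re := by
    have h2 : Continuous fun a : ℓ²(ℕ, ℂ) => (inner ℂ (dirichletKernel w) a : ℂ).re := by
      fun_prop
    exact hNcont.sub h2
  have hsingle : ∀ (n : ℕ) (c : ℂ), d (lp.single 2 n c) = 0 := by
    intro n c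
    have hval : ∀ z ∈ ball (0 : ℂ) 1, inner ℂ (dirichletKernel z) (lp.single 2 n c : ℓ²(ℕ, ℂ))
        = c / (√(n + 1 : ℝ) : ℂ) * z ^ n := by
      intro z hz
      refine (hasSum_inner_dirichletKernel (mem_ball_zero_iff.1 hz) _).unique ?_
      have h := hasSum_single
        (f := fun m => (lp.single 2 n c : ℓ²(ℕ, ℂ)) m / (√(m + 1 : ℝ) : ℂ) * z ^ m) n
        fun m hm => by simp [hm]
      rwa [lp.single_apply_self] at h
    have hpoly : N (lp.single 2 n c)
        = L ((c / (√(n + 1 : ℝ) : ℂ)) • polynomialToDirichlet (Polynomial.X ^ n)) := by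
      refine hcongr _ _ fun z hz => ?_
      change inner ℂ (dirichletKernel z) (lp.single 2 n c : ℓ²(ℕ, ℂ))
        = (c / (√(n + 1 : ℝ) : ℂ)) * (Polynomial.X ^ n : Polynomial ℂ).eval z
      rw [hval z hz, Polynomial.eval_pow, Polynomial.eval_X]
    rw [hd, LinearMap.sub_apply, hpoly, map_smul, hpow, smul_eq_mul]
    change _ - inner ℂ (dirichletKernel w) (lp.single 2 n c : ℓ²(ℕ, ℂ)) = 0
    rw [hval w hwmem, sub_self]
  have hre : ∀ a, (d a).re = 0 := by
    intro a
    have hs := lp.hasSum_single (by norm_num : (2 : ENNReal) ≠ ⊤) a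
    have ht := (hdcont.tendsto a).comp hs
    refine tendsto_nhds_unique ht ?_
    have : ((fun a => (d a).re) ∘ fun s : Finset ℕ => ∑ i ∈ s, (lp.single 2 i (a i) : ℓ²(ℕ, ℂ)))
        = fun _ => 0 := by
      ext s
      simp [map_sum, hsingle]
    rw [this]
    exact tendsto_const_nhds
  have hzero : ∀ a, d a = 0 := by
    intro a
    refine Complex.ext (hre a) ?_
    have := hre (I • a)
    rw [map_smul] at this
    simpa using this
  intro f
  obtain ⟨a, ha⟩ := MemDirichlet.exists_eqOn_inner f.2
  have h := hzero a
  rw [hd, LinearMap.sub_apply, sub_eq_zero] at h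
  rw [hcongr f (dirichletSynthesis a) fun z hz => (ha hz).symm]
  exact h.trans (ha hwmem)

/-- Characterization of weighted composition operators on the Dirichlet space:
a linear map `T : 𝒟 → Hol(𝔻)` (no continuity assumed) sending nowhere-vanishing
functions to nowhere-vanishing functions is of the form `Tf = ψ·(f ∘ φ)` for
holomorphic `φ : 𝔻 → 𝔻` and `ψ : 𝔻 → ℂ∖{0}`.  Since the values of `T` are
holomorphic functions on `𝔻`, linearity and well-definedness of `T` are
expressed via equality of functions on `𝔻`. -/
theorem dirichlet_weighted_composition (T : (ℂ → ℂ) → (ℂ → ℂ))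
    (hhol : ∀ f, MemDirichlet f → DifferentiableOn ℂ (T f) (Metric.ball 0 1))
    (hadd : ∀ f g, MemDirichlet f → MemDirichlet g →
      Set.EqOn (T (f + g)) (T f + T g) (Metric.ball 0 1))
    (hsmul : ∀ (c : ℂ) (f), MemDirichlet f →
      Set.EqOn (T (c • f)) (c • T f) (Metric.ball 0 1))
    (hcong : ∀ f g, MemDirichlet f → MemDirichlet g →
      Set.EqOn f g (Metric.ball 0 1) → Set.EqOn (T f) (T g) (Metric.ball 0 1))
    (hnv : ∀ g, MemDirichlet g → (∀ z ∈ Metric.ball (0 : ℂ) 1, g z ≠ 0) →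
      ∀ z ∈ Metric.ball (0 : ℂ) 1, T g z ≠ 0) :
    ∃ φ ψ : ℂ → ℂ,
      DifferentiableOn ℂ φ (Metric.ball 0 1) ∧
      DifferentiableOn ℂ ψ (Metric.ball 0 1) ∧
      (∀ z ∈ Metric.ball (0 : ℂ) 1, φ z ∈ Metric.ball (0 : ℂ) 1) ∧
      (∀ z ∈ Metric.ball (0 : ℂ) 1, ψ z ≠ 0) ∧
      (∀ f, MemDirichlet f → ∀ z ∈ Metric.ball (0 : ℂ) 1, T f z = ψ z * f (φ z)) := by
  set one : ℂ → ℂ := (polynomialToDirichlet 1).1 with hone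
  have hone_mem : MemDirichlet one := (polynomialToDirichlet 1).2
  set ident : ℂ → ℂ := (polynomialToDirichlet Polynomial.X).1 with hident
  have hident_mem : MemDirichlet ident := (polynomialToDirichlet Polynomial.X).2
  have hψ : ∀ z ∈ ball (0 : ℂ) 1, T one z ≠ 0 := by
    refine hnv one hone_mem fun z _ => ?_
    change (1 : Polynomial ℂ).eval z ≠ 0
    simp
  have key : ∀ z ∈ ball (0 : ℂ) 1, T ident z / T one z ∈ ball (0 : ℂ) 1 ∧
      ∀ f, MemDirichlet f → T f z / T one z = f (T ident z / T one z) := by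
    intro z hz
    let L : dirichletSubmodule →ₗ[ℂ] ℂ :=
      { toFun := fun f => T f.1 z / T one z
        map_add' := fun f g => by
          change T (f.1 + g.1) z / _ = _
          rw [hadd f.1 g.1 f.2 g.2 hz, Pi.add_apply, add_div]
        map_smul' := fun c f => by
          change T (c • f.1) z / _ = _
          rw [hsmul c f.1 f.2 hz, Pi.smul_apply, smul_eq_mul, mul_div_assoc]
          rfl }
    obtain ⟨hmem, heval⟩ := exists_eq_eval_of_ne_zero L
      (fun f g hfg => congrArg (· / T one z) (hcong f.1 g.1 f.2 g.2 hfg hz))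
      (div_self (hψ z hz)) fun f hf => div_ne_zero (hnv f.1 f.2 hf z hz) (hψ z hz)
    exact ⟨hmem, fun f hf => heval ⟨f, hf⟩⟩
  refine ⟨fun z => T ident z / T one z, T one, ?_, hhol one hone_mem, fun z hz => (key z hz).1,
    hψ, fun f hf z hz => ?_⟩
  · exact (hhol ident hident_mem).div (hhol one hone_mem) hψ
  · rw [← (key z hz).2 f hf, mul_div_cancel₀ _ (hψ z hz)]
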